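/- There exists a topological embedding g : ℕ × 2^ℕ → ℝ whose range is a closed subset of ℝ, such that λ(g(A)) = (c ⊗ μ)(A) for every closed set A ⊆ ℕ × 2^ℕ, where λ is Lebesgue measure on ℝ. (One may take g(n,p) = 3n + 2·f(p), where f is an embedding of 2^ℕ onto the Smith–Volterra–Cantor set of measure 1/2.) -/

import Mathlib

open MeasureTheory ENNReal

/-- The cylinder of all binary sequences in Cantor space having the finite binary word `w`
as a prefix. -/
def cantorCyl (w : List Bool) : Set (ℕ → Bool) :=
  {p | ∀ i : Fin w.length, p i = w.get i}

/-- The sum `∑ p_k x ^ (k + 1)` attached to a binary sequence `p`. -/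
noncomputable def bitSeries (x : ℝ) (p : ℕ → Bool) : ℝ :=
  ∑' k, if p k then x ^ (k + 1) else 0

section bitSeries

variable {x : ℝ}

theorem summable_pow_succ (h0 : 0 ≤ x) (h1 : x < 1) : Summable fun k : ℕ => x ^ (k + 1) :=
  (summable_nat_add_iff 1).2 (summable_geometric_of_lt_one h0 h1)

theorem summable_bitSeries (h0 : 0 ≤ x) (h1 : x < 1) (p : ℕ → Bool) :
    Summable fun k => if p k then x ^ (k + 1) else 0 := by
  refine Summable.of_nonneg_of_le (fun k => ?_) (fun k => ?_) (summable_pow_succ h0 h1)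
  · split_ifs <;> positivity
  · split_ifs
    · exact le_rfl
    · positivity

theorem continuous_bitSeries (h0 : 0 ≤ x) (h1 : x < 1) : Continuous (bitSeries x) := by
  refine continuous_tsum (fun k => ?_) (summable_pow_succ h0 h1) (fun k p => ?_)
  · exact (continuous_of_discreteTopology (f := fun b : Bool => if b then x ^ (k + 1) else 0)).comp
      (continuous_apply k)
  · have : 0 ≤ x ^ (k + 1) := by positivity
    split_ifs <;> simp [abs_of_nonneg, *]

theorem bitSeries_nonneg (h0 : 0 ≤ x) (p : ℕ → Bool) : 0 ≤ bitSeries x p :=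
  tsum_nonneg fun k => by split_ifs <;> positivity

theorem bitSeries_le (h0 : 0 ≤ x) (h1 : x < 1) (p : ℕ → Bool) :
    bitSeries x p ≤ x * (1 - x)⁻¹ := by
  rw [← tsum_geometric_of_lt_one h0 h1, ← tsum_mul_left]
  refine (summable_bitSeries h0 h1 p).tsum_le_tsum (fun k => ?_)
    ((summable_geometric_of_lt_one h0 h1).mul_left x)
  rw [← pow_succ']
  split_ifs
  · exact le_rfl
  · positivity

theorem bitSeries_eq_mul_shift (h0 : 0 ≤ x) (h1 : x < 1) (p : ℕ → Bool) :
    bitSeries x p = x * ((if p 0 then 1 else 0) + bitSeries x fun k => p (k + 1)) := by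
  rw [bitSeries, (summable_bitSeries h0 h1 p).tsum_eq_zero_add, bitSeries, mul_add, ← tsum_mul_left]
  simp [pow_succ']

theorem bitSeries_le_pow (h0 : 0 ≤ x) (h1 : x ≤ 1 / 2) (n : ℕ) (p : ℕ → Bool)
    (hp : ∀ i < n, p i = false) : bitSeries x p ≤ x ^ n := by
  induction n generalizing p with
  | zero =>
    refine (bitSeries_le h0 (by linarith) p).trans ?_
    rw [← div_eq_mul_inv, pow_zero, div_le_one (by linarith)]
    linarith
  | succ n ih =>
    rw [bitSeries_eq_mul_shift h0 (by linarith), hp 0 (by omega), pow_succ']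
    have := ih (fun k => p (k + 1)) fun i hi => hp (i + 1) (by omega)
    simpa using mul_le_mul_of_nonneg_left this h0

theorem bitSeries_le_of_lex (h0 : 0 ≤ x) (h1 : x ≤ 1 / 2) (n : ℕ) (p q : ℕ → Bool)
    (h : ∀ i < n, p i = q i) (hp : p n = false) (hq : q n = true) :
    bitSeries x p ≤ bitSeries x q := by
  induction n generalizing p q with
  | zero =>
    rw [bitSeries_eq_mul_shift h0 (by linarith) p, bitSeries_eq_mul_shift h0 (by linarith) q, hp, hq]
    refine mul_le_mul_of_nonneg_left ?_ h0
    have h2 := bitSeries_le_pow h0 h1 0 (fun k => p (k + 1)) (by simp)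
    have h3 := bitSeries_nonneg h0 fun k => q (k + 1)
    simp only [Bool.false_eq_true, if_false, if_true, pow_zero] at *
    linarith
  | succ n ih =>
    rw [bitSeries_eq_mul_shift h0 (by linarith) p, bitSeries_eq_mul_shift h0 (by linarith) q,
      h 0 (by omega)]
    refine mul_le_mul_of_nonneg_left ?_ h0
    gcongr
    exact ih _ _ (fun i hi => h (i + 1) (by omega)) hp hq

theorem bitSeries_lt_of_lex (h0 : 0 < x) (h1 : x < 1 / 2) (n : ℕ) (p q : ℕ → Bool)
    (h : ∀ i < n, p i = q i) (hp : p n = false) (hq : q n = true) :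
    bitSeries x p < bitSeries x q := by
  induction n generalizing p q with
  | zero =>
    rw [bitSeries_eq_mul_shift h0.le (by linarith) p, bitSeries_eq_mul_shift h0.le (by linarith) q,
      hp, hq]
    refine mul_lt_mul_of_pos_left ?_ h0
    have h2 := bitSeries_le h0.le (by linarith) (fun k => p (k + 1))
    have h3 := bitSeries_nonneg h0.le fun k => q (k + 1)
    have h4 : x * (1 - x)⁻¹ < 1 := by
      rw [← div_eq_mul_inv, div_lt_one (by linarith)]
      linarith
    simp only [Bool.false_eq_true, if_false, if_true]
    linarith
  | succ n ih =>
    rw [bitSeries_eq_mul_shift h0.le (by linarith) p, bitSeries_eq_mul_shift h0.le (by linarith) q,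
      h 0 (by omega)]
    refine mul_lt_mul_of_pos_left ?_ h0
    gcongr
    exact ih _ _ (fun i hi => h (i + 1) (by omega)) hp hq

theorem bitSeries_or (h0 : 0 ≤ x) (h1 : x < 1) (p q : ℕ → Bool)
    (h : ∀ k, p k = false ∨ q k = false) :
    bitSeries x (fun k => p k || q k) = bitSeries x p + bitSeries x q := by
  rw [bitSeries, bitSeries, bitSeries,
    ← (summable_bitSeries h0 h1 p).tsum_add (summable_bitSeries h0 h1 q)]
  refine tsum_congr fun k => ?_
  rcases h k with hk | hk <;> simp [hk]

end bitSeries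

theorem Ico_subset_range_bitSeries_half : Set.Ico 0 1 ⊆ Set.range (bitSeries (1 / 2)) := by
  intro y hy
  refine ⟨fun k => Real.digits y 2 k == 1, ?_⟩
  refine Eq.trans ?_ (Real.ofDigits_digits (b := 2) (by norm_num) hy)
  rw [bitSeries, Real.ofDigits]
  refine tsum_congr fun k => ?_
  rw [Real.ofDigitsTerm]
  generalize Real.digits y 2 k = d
  fin_cases d <;> simp

/-- An embedding of Cantor space into `ℝ` whose image has Lebesgue measure `1`. -/
noncomputable def fatCantor (p : ℕ → Bool) : ℝ :=
  bitSeries (1 / 2) p + bitSeries (1 / 4) p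

theorem continuous_fatCantor : Continuous fatCantor :=
  (continuous_bitSeries (by norm_num) (by norm_num)).add
    (continuous_bitSeries (by norm_num) (by norm_num))

theorem fatCantor_nonneg (p : ℕ → Bool) : 0 ≤ fatCantor p :=
  add_nonneg (bitSeries_nonneg (by norm_num) p) (bitSeries_nonneg (by norm_num) p)

theorem fatCantor_le_of_prefix (n : ℕ) (p : ℕ → Bool) (hp : ∀ i < n, p i = false) :
    fatCantor p ≤ (1 / 2) ^ n + (1 / 4) ^ n :=
  add_le_add (bitSeries_le_pow (by norm_num) (by norm_num) n p hp)
    (bitSeries_le_pow (by norm_num) (by norm_num) n p hp)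

theorem fatCantor_le_two (p : ℕ → Bool) : fatCantor p ≤ 2 := by
  have := fatCantor_le_of_prefix 0 p (by simp)
  norm_num at this
  exact this

/-- Two distinct binary sequences are, up to order, lexicographically increasing. -/
theorem exists_lex_of_ne {p q : ℕ → Bool} (h : p ≠ q) :
    ∃ n, (∀ i < n, p i = q i) ∧
      (p n = false ∧ q n = true ∨ q n = false ∧ p n = true) := by
  refine ⟨PiNat.firstDiff p q, fun i hi => PiNat.apply_eq_of_lt_firstDiff hi, ?_⟩
  have := PiNat.apply_firstDiff_ne h
  revert this
  cases p (PiNat.firstDiff p q) <;> cases q (PiNat.firstDiff p q) <;> simp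

theorem injective_fatCantor : Function.Injective fatCantor := by
  intro p q hpq
  by_contra hne
  have key : ∀ (n : ℕ) (p q : ℕ → Bool), (∀ i < n, p i = q i) → p n = false → q n = true →
      fatCantor p < fatCantor q := fun n p q h hp hq =>
    add_lt_add_of_le_of_lt (bitSeries_le_of_lex (by norm_num) (by norm_num) n p q h hp hq)
      (bitSeries_lt_of_lex (by norm_num) (by norm_num) n p q h hp hq)
  obtain ⟨n, h, ⟨hp, hq⟩ | ⟨hq, hp⟩⟩ := exists_lex_of_ne hne
  · exact (key n p q h hp hq).ne hpq
  · exact (key n q p (fun i hi => (h i hi).symm) hq hp).ne hpq.symm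

theorem abs_bitSeries_half_sub_le (p q : ℕ → Bool) :
    |bitSeries (1 / 2) p - bitSeries (1 / 2) q| ≤ |fatCantor p - fatCantor q| := by
  have key : ∀ (n : ℕ) (p q : ℕ → Bool), (∀ i < n, p i = q i) → p n = false → q n = true →
      |bitSeries (1 / 2) q - bitSeries (1 / 2) p| ≤ |fatCantor q - fatCantor p| := by
    intro n p q h hp hq
    have h2 := bitSeries_le_of_lex (x := 1 / 2) (by norm_num) (by norm_num) n p q h hp hq
    have h4 := bitSeries_le_of_lex (x := 1 / 4) (by norm_num) (by norm_num) n p q h hp hq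
    rw [abs_of_nonneg (by linarith)]
    refine le_trans ?_ (le_abs_self _)
    rw [fatCantor, fatCantor]
    linarith
  rcases eq_or_ne p q with rfl | hne
  · simp
  obtain ⟨n, h, ⟨hp, hq⟩ | ⟨hq, hp⟩⟩ := exists_lex_of_ne hne
  · rw [abs_sub_comm, abs_sub_comm (fatCantor p)]
    exact key n p q h hp hq
  · exact key n q p (fun i hi => (h i hi).symm) hq hp

theorem one_le_volume_range_fatCantor : 1 ≤ volume (Set.range fatCantor) := by
  have hinv := Function.leftInverse_invFun injective_fatCantor
  have hlip : LipschitzOnWith 1 (bitSeries (1 / 2) ∘ Function.invFun fatCantor)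
      (Set.range fatCantor) := by
    refine LipschitzOnWith.of_dist_le_mul ?_
    rintro _ ⟨p, rfl⟩ _ ⟨q, rfl⟩
    simpa [hinv p, hinv q, Real.dist_eq] using abs_bitSeries_half_sub_le p q
  have himage : (bitSeries (1 / 2) ∘ Function.invFun fatCantor) '' Set.range fatCantor =
      Set.range (bitSeries (1 / 2)) := by
    rw [← Set.range_comp, Function.comp_assoc, hinv.comp_eq_id, Function.comp_id]
  have hle := hlip.hausdorffMeasure_image_le zero_le_one
  rw [himage, hausdorffMeasure_real] at hle
  calc (1 : ℝ≥0∞) = volume (Set.Ico (0 : ℝ) 1) := by simp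
    _ ≤ volume (Set.range (bitSeries (1 / 2))) := measure_mono Ico_subset_range_bitSeries_half
    _ ≤ volume (Set.range fatCantor) := by simpa using hle

theorem measurableEmbedding_fatCantor : MeasurableEmbedding fatCantor :=
  (continuous_fatCantor.isClosedEmbedding injective_fatCantor).measurableEmbedding

/-- All cylinders of the same length have images of the same Lebesgue measure. -/
theorem volume_fatCantor_image_cylinder_eq (w : ℕ → Bool) (n : ℕ) :
    volume (fatCantor '' PiNat.cylinder w n) =
      volume (fatCantor '' PiNat.cylinder (fun _ => false) n) := by
  set u : ℕ → Bool := fun k => decide (k < n) && w k with hu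
  have htrans : fatCantor '' PiNat.cylinder w n =
      (fun y => fatCantor u + y) '' (fatCantor '' PiNat.cylinder (fun _ => false) n) := by
    have hadd : ∀ p ∈ PiNat.cylinder (fun _ => false) n,
        fatCantor (fun k => u k || p k) = fatCantor u + fatCantor p := by
      intro p hp
      have hdisj : ∀ k, u k = false ∨ p k = false := by
        intro k
        by_cases hk : k < n
        · exact Or.inr (hp k hk)
        · simp [hu, hk]
      rw [fatCantor, bitSeries_or (by norm_num) (by norm_num) u p hdisj,
        bitSeries_or (by norm_num) (by norm_num) u p hdisj, fatCantor, fatCantor]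
      ring
    rw [Set.image_image]
    ext y
    constructor
    · rintro ⟨p, hp, rfl⟩
      have hq : (fun k => decide (n ≤ k) && p k) ∈ PiNat.cylinder (fun _ => false) n := by
        intro k hk
        simp [hk]
      refine ⟨_, hq, ?_⟩
      dsimp only
      rw [← hadd _ hq]
      congr 1
      ext k
      by_cases hk : k < n
      · simp [hu, hk, hp k hk]
      · simp [hu, hk, not_lt.1 hk]
    · rintro ⟨p, hp, rfl⟩
      refine ⟨_, ?_, hadd p hp⟩
      intro k hk
      simp [hu, hk, hp k hk]
  rw [htrans, Set.image_add_left, measure_preimage_add]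

theorem volume_fatCantor_image_cylinder_succ (n : ℕ) :
    volume (fatCantor '' PiNat.cylinder (fun _ => false) n) =
      2 * volume (fatCantor '' PiNat.cylinder (fun _ => false) (n + 1)) := by
  set z : ℕ → Bool := fun _ => false with hz
  have hsplit : PiNat.cylinder z n =
      PiNat.cylinder z (n + 1) ∪ PiNat.cylinder (Function.update z n true) (n + 1) := by
    ext p
    simp only [PiNat.mem_cylinder_iff, Set.mem_union]
    constructor
    · intro h
      cases hpn : p n
      · left
        intro i hi
        rcases (Nat.lt_succ_iff_lt_or_eq.1 hi) with hi | rfl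
        · exact h i hi
        · exact hpn
      · right
        intro i hi
        rcases (Nat.lt_succ_iff_lt_or_eq.1 hi) with hi | rfl
        · rw [h i hi, Function.update_of_ne hi.ne]
        · simpa using hpn
    · rintro (h | h) i hi
      · exact h i (by omega)
      · rw [h i (by omega), Function.update_of_ne hi.ne]
  have hdisj : Disjoint (PiNat.cylinder z (n + 1))
      (PiNat.cylinder (Function.update z n true) (n + 1)) := by
    rw [Set.disjoint_left]
    intro p hp hq
    have h1 := hp n (by omega)
    have h2 := hq n (by omega)
    simp [h1, hz] at h2
  rw [hsplit, Set.image_union, measure_union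
    ((Set.disjoint_image_iff injective_fatCantor).2 hdisj)
    (measurableEmbedding_fatCantor.measurableSet_image.2
      (PiNat.isOpen_cylinder _ _ _).measurableSet),
    volume_fatCantor_image_cylinder_eq (Function.update z n true), two_mul]

theorem volume_range_fatCantor_eq_two_pow_mul (n : ℕ) :
    volume (Set.range fatCantor) =
      2 ^ n * volume (fatCantor '' PiNat.cylinder (fun _ => false) n) := by
  induction n with
  | zero => simp [PiNat.cylinder_zero]
  | succ n ih => rw [ih, volume_fatCantor_image_cylinder_succ, pow_succ, mul_assoc]

theorem volume_range_fatCantor : volume (Set.range fatCantor) = 1 := by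
  refine le_antisymm ?_ one_le_volume_range_fatCantor
  have hbound : ∀ n : ℕ, volume (Set.range fatCantor) ≤ ENNReal.ofReal (1 + (1 / 2) ^ n) := by
    intro n
    have hsub : fatCantor '' PiNat.cylinder (fun _ => false) n ⊆
        Set.Icc 0 ((1 / 2) ^ n + (1 / 4) ^ n) := by
      rintro _ ⟨p, hp, rfl⟩
      exact ⟨fatCantor_nonneg p, fatCantor_le_of_prefix n p hp⟩
    calc volume (Set.range fatCantor)
        = 2 ^ n * volume (fatCantor '' PiNat.cylinder (fun _ => false) n) :=
          volume_range_fatCantor_eq_two_pow_mul n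
      _ ≤ 2 ^ n * volume (Set.Icc (0 : ℝ) ((1 / 2) ^ n + (1 / 4) ^ n)) := by gcongr
      _ = ENNReal.ofReal (2 ^ n * ((1 / 2) ^ n + (1 / 4) ^ n)) := by
          rw [Real.volume_Icc, sub_zero, ENNReal.ofReal_mul (by positivity),
            ENNReal.ofReal_pow (by norm_num)]
          simp
      _ = ENNReal.ofReal (1 + (1 / 2) ^ n) := by
          rw [mul_add, ← mul_pow, ← mul_pow]
          norm_num
  have hlim : Filter.Tendsto (fun n : ℕ => ENNReal.ofReal (1 + (1 / 2) ^ n)) Filter.atTop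
      (nhds 1) := by
    have := (tendsto_pow_atTop_nhds_zero_of_lt_one (r := (1 / 2 : ℝ)) (by norm_num)
      (by norm_num)).const_add 1
    simpa [Function.comp_def] using (ENNReal.continuous_ofReal.tendsto _).comp this
  exact ge_of_tendsto' hlim hbound

theorem volume_fatCantor_image_cylinder (w : ℕ → Bool) (n : ℕ) :
    volume (fatCantor '' PiNat.cylinder w n) = (2 : ℝ≥0∞)⁻¹ ^ n := by
  have h := volume_range_fatCantor_eq_two_pow_mul n
  rw [volume_range_fatCantor] at h
  rw [volume_fatCantor_image_cylinder_eq, ← ENNReal.inv_pow]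
  exact ENNReal.eq_inv_of_mul_eq_one_left (by rw [mul_comm, ← h])

theorem isPiSystem_cylinder :
    IsPiSystem {s : Set (ℕ → Bool) | ∃ x n, s = PiNat.cylinder x n} := by
  rintro _ ⟨x, m, rfl⟩ _ ⟨y, n, rfl⟩ ⟨p, hpx, hpy⟩
  rw [← PiNat.mem_cylinder_iff_eq.1 hpx, ← PiNat.mem_cylinder_iff_eq.1 hpy]
  rcases le_total m n with h | h
  · exact ⟨p, n, Set.inter_eq_right.2 (PiNat.cylinder_anti p h)⟩
  · exact ⟨p, m, Set.inter_eq_left.2 (PiNat.cylinder_anti p h)⟩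

theorem cantorCyl_ofFn (w : ℕ → Bool) (n : ℕ) :
    cantorCyl (List.ofFn fun i : Fin n => w i) = PiNat.cylinder w n := by
  ext p
  simp only [cantorCyl, Set.mem_ofPred_eq, PiNat.mem_cylinder_iff]
  constructor
  · intro h i hi
    simpa using h ⟨i, by simpa using hi⟩
  · intro h i
    simpa using h i (by simpa using i.2)

/-- The fair-coin measure is the pullback of Lebesgue measure along `fatCantor`. -/
theorem eq_comap_fatCantor (μ : Measure (ℕ → Bool))
    (hμ : ∀ w : List Bool, μ (cantorCyl w) = (2 : ℝ≥0∞)⁻¹ ^ w.length) :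
    μ = volume.comap fatCantor := by
  have hcyl : ∀ (w : ℕ → Bool) (n : ℕ),
      μ (PiNat.cylinder w n) = volume.comap fatCantor (PiNat.cylinder w n) := by
    intro w n
    rw [measurableEmbedding_fatCantor.comap_apply, volume_fatCantor_image_cylinder,
      ← cantorCyl_ofFn, hμ, List.length_ofFn]
  have huniv : μ Set.univ = 1 := by
    simpa [cantorCyl] using hμ []
  have : IsFiniteMeasure μ := ⟨by simp [huniv]⟩
  refine ext_of_generate_finite _ ?_ isPiSystem_cylinder ?_ ?_
  · rw [BorelSpace.measurable_eq (α := ℕ → Bool)]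
    exact (PiNat.isTopologicalBasis_cylinders fun _ => Bool).borel_eq_generateFrom
  · rintro _ ⟨w, n, rfl⟩
    exact hcyl w n
  · simpa [PiNat.cylinder_zero] using hcyl (fun _ => false) 0

/-- Countably many disjoint translates of `fatCantor`. -/
noncomputable def fatCantorCopies (a : ℕ × (ℕ → Bool)) : ℝ :=
  3 * a.1 + fatCantor a.2

theorem continuous_fatCantorCopies : Continuous fatCantorCopies := by
  have h : Continuous fun a : ℕ × (ℕ → Bool) => (a.1 : ℝ) :=
    continuous_of_discreteTopology.comp continuous_fst
  exact (continuous_const.mul h).add (continuous_fatCantor.comp continuous_snd)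

theorem injective_fatCantorCopies : Function.Injective fatCantorCopies := by
  rintro ⟨m, p⟩ ⟨n, q⟩ h
  simp only [fatCantorCopies] at h
  have hp := fatCantor_nonneg p
  have hq := fatCantor_nonneg q
  have hp' := fatCantor_le_two p
  have hq' := fatCantor_le_two q
  have hmn : m < n + 1 := by
    have : (m : ℝ) < n + 1 := by linarith
    exact_mod_cast this
  have hnm : n < m + 1 := by
    have : (n : ℝ) < m + 1 := by linarith
    exact_mod_cast this
  obtain rfl : m = n := by omega
  rw [injective_fatCantor (add_left_cancel h)]

theorem isClosedEmbedding_fatCantorCopies : Topology.IsClosedEmbedding fatCantorCopies := by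
  refine .of_continuous_injective_isClosedMap continuous_fatCantorCopies
    injective_fatCantorCopies (isProperMap_iff_isCompact_preimage.2
      ⟨continuous_fatCantorCopies, fun K hK => ?_⟩).isClosedMap
  obtain ⟨B, hB⟩ := hK.bddAbove
  obtain ⟨N, hN⟩ := exists_nat_gt B
  refine ((Set.finite_Iic N).isCompact.prod isCompact_univ).of_isClosed_subset
    (hK.isClosed.preimage continuous_fatCantorCopies) ?_
  rintro ⟨n, p⟩ h
  have h1 : 3 * (n : ℝ) + fatCantor p ≤ B := hB h
  have h2 := fatCantor_nonneg p
  have h3 : (n : ℝ) ≤ N := by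
    have : (0 : ℝ) ≤ n := n.cast_nonneg
    linarith
  exact ⟨by exact_mod_cast h3, trivial⟩

/-- There is a topological embedding `g : ℕ × 2^ℕ → ℝ` with closed range such that
`λ(g(A)) = (c ⊗ μ)(A)` for every closed `A ⊆ ℕ × 2^ℕ`, where `c` is counting measure on
`ℕ`, `μ` the fair-coin measure on Cantor space (characterized by `μ([w]) = 2^{-|w|}` on
cylinders) and `λ` Lebesgue measure on `ℝ`. -/
theorem stmt7 (μ : Measure (ℕ → Bool))
    (hμ : ∀ w : List Bool, μ (cantorCyl w) = (2 : ℝ≥0∞)⁻¹ ^ w.length) :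

    ∃ g : ℕ × (ℕ → Bool) → ℝ, Topology.IsEmbedding g ∧ IsClosed (Set.range g) ∧
      ∀ A : Set (ℕ × (ℕ → Bool)), IsClosed A →
        volume (g '' A) = (Measure.prod (Measure.count : Measure ℕ) μ) A := by
  have hvol : ∀ B : Set (ℕ → Bool), volume (fatCantor '' B) = μ B := fun B => by
    rw [eq_comap_fatCantor μ hμ, measurableEmbedding_fatCantor.comap_apply]
  have : SFinite μ := by
    have : IsFiniteMeasure μ := ⟨by rw [← hvol, Set.image_univ, volume_range_fatCantor]; simp⟩
    infer_instance
  refine ⟨fatCantorCopies, isClosedEmbedding_fatCantorCopies.isEmbedding,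
    isClosedEmbedding_fatCantorCopies.isClosed_range, fun A hA => ?_⟩
  have hunion : A = ⋃ n : ℕ, Prod.mk n '' (Prod.mk n ⁻¹' A) := by
    ext ⟨n, p⟩
    simp
  rw [Measure.prod_apply hA.measurableSet, lintegral_count]
  conv_lhs => rw [hunion, Set.image_iUnion]
  rw [measure_iUnion]
  · refine tsum_congr fun n => ?_
    have himage : fatCantorCopies '' (Prod.mk n '' (Prod.mk n ⁻¹' A)) =
        (fun y => 3 * (n : ℝ) + y) '' (fatCantor '' (Prod.mk n ⁻¹' A)) := by
      simp only [Set.image_image, fatCantorCopies]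
    rw [himage, Set.image_add_left, measure_preimage_add, hvol]
  · intro m n hmn
    refine (Set.disjoint_image_iff injective_fatCantorCopies).2 ?_
    rw [Set.disjoint_left]
    rintro _ ⟨p, -, rfl⟩ ⟨q, -, h⟩
    exact hmn (Prod.ext_iff.1 h).1.symm
  · intro n
    refine (isClosedEmbedding_fatCantorCopies.isClosedMap _ ?_).measurableSet
    have hemb : Topology.IsClosedEmbedding (Prod.mk n : (ℕ → Bool) → ℕ × (ℕ → Bool)) :=
      (Continuous.prodMk_right n).isClosedEmbedding (Prod.mk_right_injective n)
    exact hemb.isClosedMap _ (hA.preimage hemb.continuous)
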